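/- For all real numbers x and y with 0 < x ≤ π and 0 < y ≤ π, one has 0 ≤ (x/y + y/x)·sin x·sin y ≤ 2, with equality to 2 when x = y = π/2. -/

import Mathlib

open Real

lemma cos_le_one_sub_sq_div_two_add_pow_four_div {x : ℝ} (hx : x ^ 2 ≤ 24) :
    cos x ≤ 1 - x ^ 2 / 2 + x ^ 4 / 24 := by
  wlog h : 0 ≤ x generalizing x
  · have := this (x := -x) (by nlinarith) (by linarith)
    rw [cos_neg] at this
    nlinarith
  have h₁ : 0 ≤ x / 2 - (x / 2) ^ 3 / 6 := by nlinarith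
  have h₂ := pow_le_pow_left₀ h₁ (sin_ge_sub_cube (x := x / 2) (by linarith)) 2
  have h₃ := cos_two_mul_eq_one_sub (x / 2)
  rw [mul_div_cancel₀ x two_ne_zero] at h₃
  nlinarith [sq_nonneg (x ^ 3)]

lemma sin_half_pi_mul_le {u : ℝ} (h₀ : 0 ≤ u) (h₂ : u ≤ 2) :
    sin (π / 2 * u) ≤ 1 - 1.2336 * (u - 1) ^ 2 + 0.2537 * (u - 1) ^ 4 := by
  have hp : 9.869 ≤ π ^ 2 := by nlinarith [pi_gt_d6]
  have hp' : π ^ 2 ≤ 9.8697 := by nlinarith [pi_lt_d6, pi_pos]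
  have ht : (u - 1) ^ 2 ≤ 1 := by nlinarith
  have h := cos_le_one_sub_sq_div_two_add_pow_four_div (x := π / 2 * (u - 1)) (by nlinarith)
  have h' : cos (π / 2 * (u - 1)) = sin (π / 2 * u) := by
    rw [← cos_sub_pi_div_two]; ring_nf
  have hp4 : π ^ 4 ≤ 97.411 := by nlinarith
  rw [h'] at h
  have e₁ := mul_le_mul_of_nonneg_right hp (sq_nonneg (u - 1))
  have e₂ := mul_le_mul_of_nonneg_right hp4 (sq_nonneg ((u - 1) ^ 2))
  nlinarith

lemma sin_half_pi_mul_sq_le {u : ℝ} (h₀ : 0 ≤ u) (h₂ : u ≤ 2) :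
    sin (π / 2 * u) ^ 2 ≤
      1 - 2.467 * (u - 1) ^ 2 + 2.03 * (u - 1) ^ 4 - 0.56 * (u - 1) ^ 6 := by
  have hs : 0 ≤ sin (π / 2 * u) :=
    sin_nonneg_of_nonneg_of_le_pi (by positivity) (by nlinarith [pi_pos])
  refine (pow_le_pow_left₀ hs (sin_half_pi_mul_le h₀ h₂) 2).trans ?_
  have ht : (u - 1) ^ 2 ≤ 1 := by nlinarith
  have e := mul_le_mul_of_nonneg_left ht (pow_nonneg (sq_nonneg (u - 1)) 3)
  nlinarith [sq_nonneg (u - 1), sq_nonneg ((u - 1) ^ 2), sq_nonneg ((u - 1) ^ 3)]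

lemma sin_half_pi_mul_le_of_le_half {u : ℝ} (h₀ : 0 ≤ u) (h₁ : u ≤ 1 / 2) :
    sin (π / 2 * u) ≤ 1.571 * u * (1 - 0.35 * u ^ 2) := by
  have hp : 9.869 ≤ π ^ 2 := by nlinarith [pi_gt_d6]
  have hx₀ : 0 ≤ π / 2 * u := by positivity
  have hx₁ : π / 2 * u ≤ 1 := by nlinarith [pi_lt_d6]
  have h := (abs_le.1 (sin_bound (abs_le.2 ⟨by linarith, hx₁⟩))).2
  rw [abs_of_nonneg hx₀] at h
  have hsq : 2.46 * u ^ 2 ≤ (π / 2 * u) ^ 2 := by nlinarith [sq_nonneg u]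
  have hx : π / 2 * u ≤ 1.571 * u := by nlinarith [pi_lt_d6]
  calc sin (π / 2 * u)
      ≤ (π / 2 * u) * (1 - (π / 2 * u) ^ 2 * (1 / 6 - (π / 2 * u) ^ 2 / 100)) := by linarith
    _ ≤ (π / 2 * u) * (1 - 0.35 * u ^ 2) := by
        refine mul_le_mul_of_nonneg_left ?_ hx₀
        have hX : (π / 2 * u) ^ 2 ≤ 1 := pow_le_one₀ hx₀ hx₁
        linarith [mul_nonneg (sq_nonneg (π / 2 * u)) (sub_nonneg.2 hX), sq_nonneg u]
    _ ≤ _ := by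
        gcongr
        nlinarith

/-- A weighted bound for `u ↦ (sin (π u / 2) (1 + u²), sin (π u / 2) (1 - u²))` left of its
contact point `u = 1` with the bounding ellipse. -/
lemma sin_sq_mul_le_of_le_one {u : ℝ} (h₀ : 1 / 2 ≤ u) (h₁ : u ≤ 1) :
    sin (π / 2 * u) ^ 2 * ((1 + u ^ 2) ^ 2 + 3 / 4 * (1 - u ^ 2) ^ 2) ≤ 4 * u ^ 2 := by
  refine (mul_le_mul_of_nonneg_right (sin_half_pi_mul_sq_le (by linarith) (by linarith))
    (by positivity)).trans ?_
  obtain ⟨s, rfl⟩ : ∃ s, u = 1 - s := ⟨1 - u, by ring⟩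
  have hs : 0 ≤ s := by linarith
  have hs' : 0 ≤ 1 - 2 * s := by linarith
  have key : 0 ≤ 2.868 - 12.736 * s + 17.267 * s ^ 2 - 1.029 * s ^ 3 - 15.77275 * s ^ 4
      + 9.73 * s ^ 5 + 2.6075 * s ^ 6 - 3.92 * s ^ 7 + 0.98 * s ^ 8 := by
    linarith [pow_nonneg hs' 8, mul_nonneg hs (pow_nonneg hs' 7),
      mul_nonneg (pow_nonneg hs 2) (pow_nonneg hs' 6),
      mul_nonneg (pow_nonneg hs 3) (pow_nonneg hs' 5),
      mul_nonneg (pow_nonneg hs 4) (pow_nonneg hs' 4),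
      mul_nonneg (pow_nonneg hs 5) (pow_nonneg hs' 3),
      mul_nonneg (pow_nonneg hs 6) (pow_nonneg hs' 2),
      mul_nonneg (pow_nonneg hs 7) hs', pow_nonneg hs 8]
  nlinarith [mul_nonneg (sq_nonneg s) key]

/-- The analogue of `sin_sq_mul_le_of_le_one` to the right of `u = 1`, with the dual weight. -/
lemma sin_sq_mul_le_of_one_le {u : ℝ} (h₁ : 1 ≤ u) (h₂ : u ≤ 2) :
    sin (π / 2 * u) ^ 2 * ((1 + u ^ 2) ^ 2 + 4 / 3 * (1 - u ^ 2) ^ 2) ≤ 4 * u ^ 2 := by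
  refine (mul_le_mul_of_nonneg_right (sin_half_pi_mul_sq_le (by linarith) h₂)
    (by positivity)).trans ?_
  obtain ⟨t, rfl⟩ : ∃ t, u = 1 + t := ⟨u - 1, by ring⟩
  have ht : 0 ≤ t := by linarith
  have hpow {m n : ℕ} (h : m ≤ n) : t ^ n ≤ t ^ m := pow_le_pow_of_le_one ht (by linarith) h
  have key : 0 ≤ 401 / 750 + 3901 / 375 * t + 22.44 * t ^ 2 + 2544.5 / 375 * t ^ 3
      - 7151.375 / 375 * t ^ 4 - 5425 / 375 * t ^ 5 + 2.73 * t ^ 6 + 3.92 / 0.75 * t ^ 7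
      + 0.98 / 0.75 * t ^ 8 := by
    linarith [hpow (show 2 ≤ 4 by norm_num), hpow (show 3 ≤ 5 by norm_num),
      hpow (show 1 ≤ 5 by norm_num), pow_nonneg ht 2, pow_nonneg ht 3, pow_nonneg ht 6,
      pow_nonneg ht 7, pow_nonneg ht 8]
  nlinarith [mul_nonneg (sq_nonneg t) key]

lemma sq_add_sq_mul_sin_mul_sin_le_of_le_half {u v : ℝ} (hu : 0 ≤ u) (hu' : u ≤ 1 / 2)
    (huv : u ≤ v) (hv : v ≤ 2) :
    (u ^ 2 + v ^ 2) * (sin (π / 2 * u) * sin (π / 2 * v)) ≤ 2 * (u * v) := by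
  have hv₀ : 0 ≤ v := hu.trans huv
  have hb₀ : 0 ≤ sin (π / 2 * v) :=
    sin_nonneg_of_nonneg_of_le_pi (by positivity) (by nlinarith [pi_pos])
  have ha := sin_half_pi_mul_le_of_le_half hu hu'
  have hb := sin_half_pi_mul_le hv₀ hv
  have hb₁ := sin_le_one (π / 2 * v)
  set b := sin (π / 2 * v)
  suffices h : 1.571 * ((1 - 0.35 * u ^ 2) * (u ^ 2 + v ^ 2)) * b ≤ 2 * v by
    have h₁ := mul_le_mul_of_nonneg_right ha
      (mul_nonneg (add_nonneg (sq_nonneg u) (sq_nonneg v)) hb₀)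
    have h₂ := mul_le_mul_of_nonneg_left h hu
    linarith
  have hu4 : u ^ 2 ≤ 1 / 4 := by nlinarith
  rcases le_total v (1 / 2) with h | h
  · have hb' : b ≤ 1.571 * v := by
      refine (sin_half_pi_mul_le_of_le_half hv₀ h).trans ?_
      nlinarith [mul_nonneg hv₀ (sq_nonneg v)]
    have : (1 - 0.35 * u ^ 2) * (u ^ 2 + v ^ 2) ≤ 1 / 2 := by
      nlinarith [sq_nonneg u, sq_nonneg v, mul_nonneg (sq_nonneg u) (sq_nonneg v)]
    nlinarith
  rcases le_total 0 (1 - 0.35 * v ^ 2) with hv' | hv'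
  · have hw : (1 - 0.35 * u ^ 2) * (u ^ 2 + v ^ 2) ≤ 0.9125 * v ^ 2 + 1 / 4 := by
      nlinarith [mul_le_mul_of_nonneg_right hu4 hv', sq_nonneg (u ^ 2)]
    refine (mul_le_mul_of_nonneg_right (mul_le_mul_of_nonneg_left hw (by norm_num)) hb₀).trans ?_
    rcases le_total v 1 with hv₁ | hv₁
    · refine (mul_le_mul_of_nonneg_left hb₁ (by positivity)).trans ?_
      nlinarith
    refine (mul_le_mul_of_nonneg_left hb (by positivity)).trans ?_
    obtain ⟨t, rfl⟩ : ∃ t, v = 1 + t := ⟨v - 1, by ring⟩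
    have ht : 0 ≤ t := by linarith
    have hpow {m n : ℕ} (h : m ≤ n) : t ^ n ≤ t ^ m := pow_le_pow_of_le_one ht (by linarith) h
    linarith [mul_nonneg ht (sq_nonneg (t - 0.23)), sq_nonneg (t - 0.2157),
      hpow (show 4 ≤ 5 by norm_num), hpow (show 4 ≤ 6 by norm_num), pow_nonneg ht 4]
  · have hw : (1 - 0.35 * u ^ 2) * (u ^ 2 + v ^ 2) ≤ v ^ 2 := by
      nlinarith [mul_nonneg (sq_nonneg u) (neg_nonneg.2 hv'), sq_nonneg (u ^ 2)]
    refine (mul_le_mul_of_nonneg_right (mul_le_mul_of_nonneg_left hw (by norm_num)) hb₀).trans ?_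
    have hv₁ : 1 ≤ v := by nlinarith
    refine (mul_le_mul_of_nonneg_left hb (by positivity)).trans ?_
    obtain ⟨t, rfl⟩ : ∃ t, v = 1 + t := ⟨v - 1, by ring⟩
    have ht : 0 ≤ t := by linarith
    have hpow {m n : ℕ} (h : m ≤ n) : t ^ n ≤ t ^ m := pow_le_pow_of_le_one ht (by linarith) h
    have key : 0 ≤ 2 - 1.571 * (1 + t) * (1 - 1.2336 * t ^ 2 + 0.2537 * t ^ 4) := by
      linarith [mul_nonneg ht (sq_nonneg (t - 0.3)), sq_nonneg (t - 0.32),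
        hpow (show 3 ≤ 4 by norm_num), hpow (show 3 ≤ 5 by norm_num), pow_nonneg ht 3]
    linarith [mul_nonneg hv₀ key]

lemma sq_add_sq_mul_sin_mul_sin_le {u v : ℝ} (hu : 0 ≤ u) (huv : u ≤ v) (hv : v ≤ 2) :
    (u ^ 2 + v ^ 2) * (sin (π / 2 * u) * sin (π / 2 * v)) ≤ 2 * (u * v) := by
  rcases le_total u (1 / 2) with h | h
  · exact sq_add_sq_mul_sin_mul_sin_le_of_le_half hu h huv hv
  have hv₀ : 0 ≤ v := hu.trans huv
  have hA : 0 ≤ sin (π / 2 * u) :=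
    sin_nonneg_of_nonneg_of_le_pi (by positivity) (by nlinarith [pi_pos])
  have hB : 0 ≤ sin (π / 2 * v) :=
    sin_nonneg_of_nonneg_of_le_pi (by positivity) (by nlinarith [pi_pos])
  have bound : ∀ w : ℝ, 1 / 2 ≤ w → w ≤ 2 → sin (π / 2 * w) * (1 + w ^ 2) ≤ 2 * w := by
    intro w h₁ h₂
    refine le_of_sq_le_sq ?_ (by linarith)
    rcases le_total w 1 with h | h
    · nlinarith [sin_sq_mul_le_of_le_one h₁ h, sq_nonneg (sin (π / 2 * w) * (1 - w ^ 2))]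
    · nlinarith [sin_sq_mul_le_of_one_le h h₂, sq_nonneg (sin (π / 2 * w) * (1 - w ^ 2))]
  have hP := mul_le_mul (bound u h (huv.trans hv)) (bound v (h.trans huv) hv)
    (by positivity) (by positivity)
  have same (hQ : 0 ≤ (1 - u ^ 2) * (1 - v ^ 2)) :
      (u ^ 2 + v ^ 2) * (sin (π / 2 * u) * sin (π / 2 * v)) ≤ 2 * (u * v) := by
    nlinarith [mul_nonneg (mul_nonneg hA hB) hQ]
  rcases le_total v 1 with hv₁ | hv₁
  · exact same (mul_nonneg (by nlinarith) (by nlinarith))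
  rcases le_total 1 u with hu₁ | hu₁
  · exact same (mul_nonneg_of_nonpos_of_nonpos (by nlinarith) (by nlinarith))
  have hl := sin_sq_mul_le_of_le_one h hu₁
  have hr := sin_sq_mul_le_of_one_le hv₁ hv
  refine le_of_sq_le_sq ?_ (by positivity)
  have hm := mul_le_mul hl hr (by positivity) (by positivity)
  nlinarith [sq_nonneg (sin (π / 2 * u) * sin (π / 2 * v) *
    (4 * (1 + u ^ 2) * (1 - v ^ 2) + 3 * (1 - u ^ 2) * (1 + v ^ 2)))]

/-- For `x, y ∈ (0, π]`, the quantity `(x/y + y/x) sin x sin y` lies in `[0, 2]`, with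
equality to 2 when `x = y = π/2`. -/
theorem ratio_sin_bound (x y : ℝ) (hx₀ : 0 < x) (hxπ : x ≤ Real.pi)
    (hy₀ : 0 < y) (hyπ : y ≤ Real.pi) :
    (0 ≤ (x / y + y / x) * Real.sin x * Real.sin y
      ∧ (x / y + y / x) * Real.sin x * Real.sin y ≤ 2)
    ∧ (x = Real.pi / 2 → y = Real.pi / 2
        → (x / y + y / x) * Real.sin x * Real.sin y = 2) := by
  have hs : 0 ≤ sin x * sin y :=
    mul_nonneg (sin_nonneg_of_nonneg_of_le_pi hx₀.le hxπ)
      (sin_nonneg_of_nonneg_of_le_pi hy₀.le hyπ)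
  refine ⟨⟨?_, ?_⟩, ?_⟩
  · rw [mul_assoc]
    positivity
  · wlog h : x ≤ y generalizing x y
    · have := this y x hy₀ hyπ hx₀ hxπ (by rwa [mul_comm]) (le_of_not_ge h)
      rwa [add_comm, mul_assoc, mul_comm (sin x), ← mul_assoc]
    have hπ := pi_pos
    have key := sq_add_sq_mul_sin_mul_sin_le (u := 2 / π * x) (v := 2 / π * y)
      (by positivity) (by gcongr) (by rw [div_mul_eq_mul_div, div_le_iff₀ hπ]; linarith)
    have e (z : ℝ) : π / 2 * (2 / π * z) = z := by field_simp
    rw [e, e] at key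
    have key' : (x ^ 2 + y ^ 2) * (sin x * sin y) ≤ 2 * (x * y) := by
      refine le_of_mul_le_mul_left ?_ (by positivity : 0 < (2 / π) ^ 2)
      linarith
    have e' : (x / y + y / x) * sin x * sin y
        = (x ^ 2 + y ^ 2) * (sin x * sin y) / (x * y) := by
      field_simp
    rw [e', div_le_iff₀ (by positivity)]
    exact key'
  · rintro rfl rfl
    rw [sin_pi_div_two, div_self hx₀.ne']
    norm_num
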